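/- arXiv:2008.07037 — 4 statements merged into one kernel-verified Lean document; each statement's English description precedes it below -/
import Mathlib

section
/- Let k ≥ 1 and 0 ≤ i < k. Let P be the k × k matrix over F_2 whose (r, c) entry (rows and columns indexed 0, …, k−1) is 1 if c ≡ r + i (mod k) and 0 otherwise, and let C ⊆ F_2^{2k} be the row space of the k × 2k matrix [I_k | P], where I_k is the k × k identity matrix. Then C is reversible: for every codeword c ∈ C (with coordinates indexed 0, …, 2k−1), the reversed word c^r defined by (c^r)_j = c_{2k−1−j} also lies in C. -/
/-- Reflecting `k - 1 - (r + i) % k` through the shift by `i` recovers `k - 1 - r`. -/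
lemma reflect_add_mod {k r i : ℕ} (hr : r < k) (hi : i < k) :
    (k - 1 - (r + i) % k + i) % k = k - 1 - r := by
  rcases lt_or_ge (r + i) k with h | h
  · rw [Nat.mod_eq_of_lt h, Nat.mod_eq_of_lt (by omega)]
    omega
  · rw [Nat.mod_eq_sub_mod h, Nat.mod_eq_of_lt (show r + i - k < k by omega),
      Nat.mod_eq_sub_mod (by omega), Nat.mod_eq_of_lt (by omega)]
    omega

/-- The binary code with generator matrix `[I_k | P]`, where `P` is the circulant
matrix of the monomial `x^i` modulo `x^k - 1`, is reversible. -/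
theorem icy_monomial_reversible
    (k : ℕ) (hk : 1 ≤ k) (i : ℕ) (hi : i < k) :
    ∀ c ∈ Submodule.span (ZMod 2)
        (Set.range fun r : Fin k => fun s : Fin (2 * k) =>
          if s.val = r.val ∨ s.val = k + (r.val + i) % k then (1 : ZMod 2) else 0),
      (fun s : Fin (2 * k) => c s.rev) ∈ Submodule.span (ZMod 2)
        (Set.range fun r : Fin k => fun s : Fin (2 * k) =>
          if s.val = r.val ∨ s.val = k + (r.val + i) % k then (1 : ZMod 2) else 0) := by
  intro c hc
  induction hc using Submodule.span_induction with
  | mem c hc =>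
    obtain ⟨r, rfl⟩ := hc
    refine Submodule.subset_span ⟨⟨k - 1 - (r.val + i) % k, by omega⟩, ?_⟩
    funext s
    have hmod := reflect_add_mod r.isLt hi
    have hlt : (r.val + i) % k < k := Nat.mod_lt _ hk
    have hr := r.isLt
    have hs := s.isLt
    simp only [hmod, Fin.val_rev]
    generalize (r.val + i) % k = m at *
    congr 1
    exact propext (by omega)
  | zero => exact Submodule.zero_mem _
  | add x y _ _ hx hy => exact Submodule.add_mem _ hx hy
  | smul a x _ hx => exact Submodule.smul_mem _ a hx
end

section
/- Let q be a prime power, let ℓ ≥ 1 and r ≥ 1. For each i = 1, …, ℓ let d_i ≥ 0, let n_i = d_i + r, and let a_{i,0}, a_{i,1}, …, a_{i,d_i} ∈ F_q. Assume that for every i = 1, …, ℓ: n_i = n_{ℓ+1−i} (equivalently d_i = d_{ℓ+1−i}) and a_{i,j} = a_{ℓ+1−i, d_i − j} for all 0 ≤ j ≤ d_i (i.e., the coefficient sequence of block i is the reversal of the coefficient sequence of block ℓ+1−i). Let N = n_1 + ⋯ + n_ℓ and let C ⊆ F_q^N be the F_q-span of the r vectors v_0, …, v_{r−1}, where the part of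 v_t lying in block i (of length n_i, positions indexed 0, …, n_i − 1) has entry a_{i, s−t} at position s when t ≤ s ≤ t + d_i and 0 otherwise (the coefficient vector of x^t·(a_{i,0} + a_{i,1}x + ⋯ + a_{i,d_i}x^{d_i})). Then C is reversible: for every c ∈ C (coordinates indexed 0, …, N−1), the reversed word c^r defined by (c^r)_s = c_{N−1−s} also lies in C. -/
/-- A multi-twisted code generated by `(g_1f_1, …, g_ℓf_ℓ)` is reversible when the
block lengths satisfy `n_i = n_{ℓ+1-i}` and the coefficient sequence of block `i`
is the reversal of that of block `ℓ+1-i` (i.e. `g_if_i = (g_{ℓ+1-i}f_{ℓ+1-i})^*`).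
Blocks are indexed by `Fin ℓ` (so `ℓ+1-i` becomes `Fin.rev`), block `i` has length
`n_i = d_i + r`, and the code is spanned by the `r` shifted coefficient vectors. -/
theorem mt_code_reversible
    {F : Type*} [Field F] [Fintype F]
    (ℓ r : ℕ) (hℓ : 1 ≤ ℓ) (hr : 1 ≤ r)
    (d : Fin ℓ → ℕ) (a : (i : Fin ℓ) → ℕ → F)
    (hd : ∀ i : Fin ℓ, d i = d i.rev)
    (ha : ∀ i : Fin ℓ, ∀ j ≤ d i, a i j = a i.rev (d i - j)) :
    ∀ c ∈ Submodule.span F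
        (Set.range fun t : Fin r => fun x : (i : Fin ℓ) × Fin (d i + r) =>
          if t.val ≤ x.2.val ∧ x.2.val ≤ t.val + d x.1 then a x.1 (x.2.val - t.val) else 0),
      (fun x : (i : Fin ℓ) × Fin (d i + r) =>
          c ⟨x.1.rev, (Fin.cast (by rw [hd x.1] : d x.1 + r = d x.1.rev + r) x.2).rev⟩)
        ∈ Submodule.span F
        (Set.range fun t : Fin r => fun x : (i : Fin ℓ) × Fin (d i + r) =>
          if t.val ≤ x.2.val ∧ x.2.val ≤ t.val + d x.1 then a x.1 (x.2.val - t.val) else 0) := by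
  intro c hc
  induction hc using Submodule.span_induction with
  | mem c h =>
    obtain ⟨t, rfl⟩ := h
    refine Submodule.subset_span ⟨t.rev, ?_⟩
    funext ⟨i, s⟩
    have hdi := hd i
    have ht := t.isLt
    have hs := s.isLt
    simp only [Fin.val_rev, Fin.val_cast]
    split_ifs with h₁ h₂ h₂
    · rw [ha i _ (by omega)]
      congr 1
      omega
    · omega
    · omega
    · rfl
  | zero => exact Submodule.zero_mem _
  | add x y _ _ hx hy => exact Submodule.add_mem _ hx hy
  | smul b x _ hx => exact Submodule.smul_mem _ b hx
end

section
/- Let q be a prime power, let a ∈ F_q with a ≠ 0, let m ≥ 1 and ℓ ≥ 1. Let g, h ∈ F_q[x] with x^m − a = g(x)·h(x), and let f_1, …, f_ℓ ∈ F_q[x] be such that gcd(h, f_i) = 1 for all i = 1, …, ℓ. Let R = F_q[x]/⟨x^m − a⟩ and let C be the R-submodule (equivalently, F_q[x]-submodule) of R^ℓ generated by the single element (g·f_1 mod (x^m − a), …, g·f_ℓ mod (x^m − a)). Then the dimension of C as an F_q-vector space equals m − deg(g). -/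
open Polynomial in
/-- The `F`-linear map `p ↦ (p mod P) • v`. -/
noncomputable def polynomialSMulVector {F ι : Type*} [Field F] (P : F[X])
    (v : ι → AdjoinRoot P) : F[X] →ₗ[F] ι → AdjoinRoot P :=
  (LinearMap.toSpanSingleton (AdjoinRoot P) (ι → AdjoinRoot P) v).restrictScalars F ∘ₗ
    (AdjoinRoot.mkₐ P).toLinearMap

open Polynomial in
theorem polynomialSMulVector_apply {F ι : Type*} [Field F] (P : F[X])
    (v : ι → AdjoinRoot P) (p : F[X]) (i : ι) :
    polynomialSMulVector P v p i = AdjoinRoot.mk P p * v i :=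
  rfl

open Polynomial in
theorem range_polynomialSMulVector {F ι : Type*} [Field F] (P : F[X])
    (v : ι → AdjoinRoot P) :
    LinearMap.range (polynomialSMulVector P v) =
      (Submodule.span (AdjoinRoot P) {v}).restrictScalars F := by
  ext w
  simp only [LinearMap.mem_range, Submodule.restrictScalars_mem, Submodule.mem_span_singleton]
  exact (AdjoinRoot.mk_surjective.exists (p := fun r : AdjoinRoot P => r • v = w)).symm

open Polynomial in
/-- If `P = g * h` is nonzero and every `f i` is coprime to `h`, then the polynomials annihilating
the vector `(g * f i mod P)` form the ideal generated by `h`. -/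
theorem ker_polynomialSMulVector {F ι : Type*} [Field F] [Nonempty ι] {P g h : F[X]}
    (hP : P ≠ 0) (hgh : P = g * h) (f : ι → F[X]) (hf : ∀ i, IsCoprime h (f i)) :
    LinearMap.ker (polynomialSMulVector P fun i => AdjoinRoot.mk P (g * f i)) =
      (Ideal.span {h}).restrictScalars F := by
  have hg : g ≠ 0 := by
    rintro rfl
    exact hP (by simpa using hgh)
  have key (p : F[X]) (i : ι) :
      AdjoinRoot.mk P p * AdjoinRoot.mk P (g * f i) = 0 ↔ h ∣ p * f i := by
    rw [← map_mul, AdjoinRoot.mk_eq_zero, mul_left_comm]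
    nth_rw 1 [hgh]
    exact mul_dvd_mul_iff_left hg
  ext p
  rw [LinearMap.mem_ker, Submodule.restrictScalars_mem, Ideal.mem_span_singleton, funext_iff]
  simp only [polynomialSMulVector_apply, Pi.zero_apply, key]
  exact ⟨fun H => (hf (Classical.arbitrary ι)).dvd_of_dvd_mul_right (H _),
    fun H i => H.mul_right _⟩

set_option maxHeartbeats 1000000 in
/-- (ASR dimension) A 1-generator quasi-twisted code generated by
`(g·f_1, …, g·f_ℓ)` with `x^m - a = g·h` and `gcd(h, f_i) = 1` for all `i`
has dimension `m - deg g` as an `F_q`-vector space. -/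
theorem qt_code_dimension
    {F : Type*} [Field F] [Fintype F]
    (m ℓ : ℕ) (hm : 1 ≤ m) (hℓ : 1 ≤ ℓ)
    (a : F) (ha : a ≠ 0)
    (g h : Polynomial F) (hgh : Polynomial.X ^ m - Polynomial.C a = g * h)
    (f : Fin ℓ → Polynomial F) (hf : ∀ i, IsCoprime h (f i)) :
    Module.finrank F
      (Submodule.restrictScalars F
        (Submodule.span (AdjoinRoot (Polynomial.X ^ m - Polynomial.C a))
          ({fun i : Fin ℓ =>
            AdjoinRoot.mk (Polynomial.X ^ m - Polynomial.C a) (g * f i)} :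
            Set (Fin ℓ → AdjoinRoot (Polynomial.X ^ m - Polynomial.C a)))))
      = m - g.natDegree := by
  have : Nonempty (Fin ℓ) := ⟨⟨0, hℓ⟩⟩
  have hP : (Polynomial.X ^ m - Polynomial.C a : Polynomial F) ≠ 0 :=
    Polynomial.X_pow_sub_C_ne_zero hm a
  have hdeg : m = g.natDegree + h.natDegree := by
    have hne := hgh ▸ hP
    rw [← Polynomial.natDegree_mul (left_ne_zero_of_mul hne) (right_ne_zero_of_mul hne), ← hgh,
      Polynomial.natDegree_X_pow_sub_C]
  rw [← range_polynomialSMulVector, ← (LinearMap.quotKerEquivRange _).finrank_eq,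
    ker_polynomialSMulVector hP hgh f hf,
    (Submodule.Quotient.restrictScalarsEquiv F (Ideal.span {h})).finrank_eq,
    finrank_quotient_span_eq_natDegree]
  omega
end

section
/- Let q be a prime power, let a ∈ F_q with a ≠ 0, let m ≥ 1 and ℓ ≥ 1. Let g, h ∈ F_q[x] with x^m − a = g(x)·h(x), and let f_1, …, f_ℓ ∈ F_q[x] be such that gcd(h, f_i) = 1 for all i = 1, …, ℓ. For a polynomial c ∈ F_q[x] of degree < m, let wt(c) denote the number of indices 0 ≤ j ≤ m−1 with coeff_j(c) ≠ 0. Let d be the minimum of wt(c) over all nonzero polynomials c of degree < m that are divisible by g (the minimum distance of the constacyclic code generated by g). Then for every tuple (c_1, …, c_ℓ) of polynomials, each of degree < m and not all zero, for which there exists u ∈ F_q[x] with c_i ≡ g·f_i·u (mod x^m − a) for all i = 1, …, ℓ, one has wt(c_1) + wt(c_2) + ⋯ + wt(c_ℓ) ≥ ℓ·d. -/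
/-- (ASR distance bound) For a 1-generator quasi-twisted code generated by
`(g·f_1, …, g·f_ℓ)` with `x^m - a = g·h` and `gcd(h, f_i) = 1` for all `i`,
every nonzero codeword `(c_1, …, c_ℓ)` has weight at least `ℓ·d`, where `d` is
the minimum distance of the constacyclic code generated by `g`. -/
theorem qt_code_distance_bound
    {F : Type*} [Field F] [Fintype F] [DecidableEq F]
    (m ℓ : ℕ) (hm : 1 ≤ m) (hℓ : 1 ≤ ℓ)
    (a : F) (ha : a ≠ 0)
    (g h : Polynomial F) (hgh : Polynomial.X ^ m - Polynomial.C a = g * h)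
    (f : Fin ℓ → Polynomial F) (hf : ∀ i, IsCoprime h (f i))
    (d : ℕ)
    (hd : IsLeast {w : ℕ | ∃ c : Polynomial F, c ≠ 0 ∧ c.degree < (m : WithBot ℕ) ∧
        g ∣ c ∧ w = (Finset.univ.filter fun j : Fin m => c.coeff j ≠ 0).card} d) :
    ∀ c : Fin ℓ → Polynomial F,
      (∀ i, (c i).degree < (m : WithBot ℕ)) → (∃ i, c i ≠ 0) →
      (∃ u : Polynomial F, ∀ i,
        (Polynomial.X ^ m - Polynomial.C a) ∣ (c i - g * f i * u)) →
      ℓ * d ≤ ∑ i : Fin ℓ, (Finset.univ.filter fun j : Fin m => (c i).coeff j ≠ 0).card := by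
  intro c hdeg hne ⟨u, hu⟩
  have hmonic : (Polynomial.X ^ m - Polynomial.C a).Monic :=
    Polynomial.monic_X_pow_sub_C a (by omega)
  have hg : g ≠ 0 := by
    rintro rfl
    exact hmonic.ne_zero (by rw [hgh, zero_mul])
  have hdvd : ∀ i, g ∣ c i := fun i => by
    have hgi : g ∣ c i - g * f i * u := (Dvd.intro h hgh.symm).trans (hu i)
    exact (dvd_sub_left (Dvd.intro (f i * u) (by ring))).mp hgi
  have hall : ∀ i, c i ≠ 0 := by
    intro i hi
    obtain ⟨j, hj⟩ := hne
    have hhu : h ∣ u := by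
      have hgu := hu i
      rw [hi, zero_sub, dvd_neg, hgh, mul_assoc] at hgu
      exact (hf i).dvd_of_dvd_mul_left ((mul_dvd_mul_iff_left hg).mp hgu)
    have hprod : Polynomial.X ^ m - Polynomial.C a ∣ g * f j * u := by
      rw [hgh, mul_assoc]
      exact mul_dvd_mul_left g (hhu.mul_left (f j))
    refine hj (Polynomial.eq_zero_of_dvd_of_degree_lt ((dvd_sub_left hprod).mp (hu j)) ?_)
    rw [Polynomial.degree_X_pow_sub_C (by omega)]
    exact hdeg j
  simpa using Finset.card_nsmul_le_sum Finset.univ _ d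
    fun i _ => hd.2 ⟨c i, hall i, hdeg i, hdvd i, rfl⟩
end
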